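/- For any positive integers n, k and any integer i with 0 ≤ i ≤ n−k, the coefficient b_{n,k}^{(i)} of z^i in (−1)^{n−k}·js_n^k(z) equals the number of ordered pairs (σ, τ) where σ is a permutation of [n]_0 = {0,1,…,n} with k cycles, τ is a permutation of [n] = {1,…,n} with k cycles, and: (i) 1 belongs to the orbit of 0 under σ; (ii) min(σ) = min(τ); (iii) rec₀(w) = i, where w is the word σ(0)σ²(0)…σ^l(0) with σ^{l+1}(0) = 0. -/

import Mathlib

open Polynomial

/-- The Jacobi-Stirling numbers of the first kind `js n k` as polynomials in `z`. -/
noncomputable def js : ℕ → ℕ → Polynomial ℤ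
  | 0, 0 => 1
  | 0, _ + 1 => 0
  | _ + 1, 0 => 0
  | n + 1, k + 1 => js n k - C (n : ℤ) * (C (n : ℤ) + X) * js n (k + 1)

/-- For a permutation `σ` of `[n]₀ = {0, 1, …, n}` (modelled on `Fin (n+1)`), the set
`min σ` of cyclic minima: those `j ∈ [n]` with `j = min (Orb_σ(j) ∩ [n])`. -/
def posMins {n : ℕ} (σ : Equiv.Perm (Fin (n + 1))) : Set (Fin (n + 1)) :=
  {j | j ≠ 0 ∧ ∀ l : ℕ, (σ ^ l) j ≠ 0 → j ≤ (σ ^ l) j}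

/-- The set of minima of all orbits of a permutation of `[n]₀` (modelled on `Fin (n+1)`);
its cardinality is the number of cycles of the permutation. -/
def allMins {n : ℕ} (σ : Equiv.Perm (Fin (n + 1))) : Set (Fin (n + 1)) :=
  {j | ∀ l : ℕ, j ≤ (σ ^ l) j}

/-- The number of records of a word `w` (a letter is a record if it is strictly smaller
than all letters preceding it). -/
def recCount (w : List ℕ) : ℕ :=
  ((Finset.range w.length).filter fun j => ∀ i < j, w.getD j 0 < w.getD i 0).card

open Equiv

noncomputable def insE (m : ℕ) : (Fin (m+1) × Perm (Fin m)) ≃ Perm (Fin (m+1)) :=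
  ((Equiv.prodCongr (finSuccEquivLast) (Equiv.inv _)).trans
    (Perm.decomposeOption.symm.trans (Equiv.inv _))).trans (permCongr finSuccEquivLast.symm)

lemma oc_symm {m : ℕ} (σ : Perm (Fin m)) : (optionCongr σ⁻¹).symm = optionCongr σ := rfl

lemma insE_last_last {m : ℕ} (σ : Perm (Fin m)) : insE m (Fin.last m, σ) (Fin.last m) = Fin.last m := by
  simp [insE, Equiv.permCongr_apply, oc_symm]

lemma insE_last_cast {m : ℕ} (σ : Perm (Fin m)) (x : Fin m) :
    insE m (Fin.last m, σ) x.castSucc = (σ x).castSucc := by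
  simp [insE, Equiv.permCongr_apply, oc_symm]

lemma insE_cast_last {m : ℕ} (a : Fin m) (σ : Perm (Fin m)) :
    insE m (a.castSucc, σ) (Fin.last m) = (σ a).castSucc := by
  simp [insE, Equiv.permCongr_apply, oc_symm]

lemma insE_cast_cast {m : ℕ} (a : Fin m) (σ : Perm (Fin m)) (x : Fin m) :
    insE m (a.castSucc, σ) x.castSucc = if x = a then Fin.last m else (σ x).castSucc := by
  by_cases h : x = a <;> simp [insE, Equiv.permCongr_apply, h, Equiv.swap_apply_of_ne_of_ne, oc_symm]

/-- induction for SameCycle -/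
lemma sc_map {α β : Type*} [Finite α] (σ : Perm α) (σ' : Perm β) (p : α → β)
    (h : ∀ x, σ'.SameCycle (p x) (p (σ x))) {x y : α} (hxy : σ.SameCycle x y) :
    σ'.SameCycle (p x) (p y) := by
  obtain ⟨i, -, rfl⟩ := hxy.exists_pow_eq'
  induction i with
  | zero => exact Perm.SameCycle.refl _ _
  | succ i ih =>
    rw [pow_succ', Perm.mul_apply]
    exact (ih ⟨i, by simp⟩).trans (h _)

lemma sc_step {α : Type*} (σ : Perm α) (x : α) : σ.SameCycle x (σ x) := ⟨1, by simp⟩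

def prj {m : ℕ} (a : Fin m) (u : Fin (m+1)) : Fin m := Fin.lastCases (motive := fun _ => Fin m) a id u

@[simp] lemma prj_last {m : ℕ} (a : Fin m) : prj a (Fin.last m) = a := by simp [prj]
@[simp] lemma prj_cast {m : ℕ} (a x : Fin m) : prj a x.castSucc = x := by simp [prj]

lemma sc_cast_last {m : ℕ} (a : Fin m) (σ : Perm (Fin m)) :
    (insE m (a.castSucc, σ)).SameCycle a.castSucc (Fin.last m) := by
  have := sc_step (insE m (a.castSucc, σ)) a.castSucc
  rwa [insE_cast_cast, if_pos rfl] at this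

lemma sc_ins {m : ℕ} (a : Fin m) (σ : Perm (Fin m)) (u v : Fin (m+1)) :
    (insE m (a.castSucc, σ)).SameCycle u v ↔ σ.SameCycle (prj a u) (prj a v) := by
  constructor
  · apply sc_map
    intro x
    induction x using Fin.lastCases with
    | last => simpa [insE_cast_last] using sc_step σ a
    | cast x =>
      rw [insE_cast_cast]
      split_ifs with h
      · simp [h, Perm.SameCycle.refl]
      · simpa using sc_step σ x
  · intro h
    have key : ∀ u : Fin (m+1), (insE m (a.castSucc, σ)).SameCycle u (prj a u).castSucc := by
      intro u
      induction u using Fin.lastCases with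
      | last => simpa using (sc_cast_last a σ).symm
      | cast x => simp [Perm.SameCycle.refl]
    refine (key u).trans (Perm.SameCycle.trans ?_ (key v).symm)
    refine sc_map σ (insE m (a.castSucc, σ)) Fin.castSucc ?_ h
    intro x
    by_cases hx : x = a
    · subst hx
      refine (sc_cast_last x σ).trans ?_
      have := sc_step (insE m (x.castSucc, σ)) (Fin.last m)
      rwa [insE_cast_last] at this
    · have := sc_step (insE m (a.castSucc, σ)) x.castSucc
      rwa [insE_cast_cast, if_neg hx] at this

lemma insE_last_pow {m : ℕ} (σ : Perm (Fin m)) (x : Fin m) (l : ℕ) :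
    (insE m (Fin.last m, σ) ^ l) x.castSucc = ((σ ^ l) x).castSucc := by
  induction l with
  | zero => simp
  | succ l ih => rw [pow_succ', Perm.mul_apply, ih, insE_last_cast, pow_succ', Perm.mul_apply]

lemma insE_last_pow_last {m : ℕ} (σ : Perm (Fin m)) (l : ℕ) :
    (insE m (Fin.last m, σ) ^ l) (Fin.last m) = Fin.last m := by
  induction l with
  | zero => simp
  | succ l ih => rw [pow_succ', Perm.mul_apply, ih, insE_last_last]

lemma sc_fix {m : ℕ} (σ : Perm (Fin m)) (x y : Fin m) :
    (insE m (Fin.last m, σ)).SameCycle x.castSucc y.castSucc ↔ σ.SameCycle x y := by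
  constructor
  · intro h
    obtain ⟨i, -, hi⟩ := h.exists_pow_eq'
    rw [insE_last_pow] at hi
    exact ⟨i, by simpa using hi⟩
  · intro h
    obtain ⟨i, -, hi⟩ := h.exists_pow_eq'
    refine ⟨i, ?_⟩
    rw [zpow_natCast, insE_last_pow, hi]

lemma mem_posMins {n : ℕ} (σ : Perm (Fin (n+1))) (j : Fin (n+1)) :
    j ∈ posMins σ ↔ j ≠ 0 ∧ ∀ y, σ.SameCycle j y → y ≠ 0 → j ≤ y := by
  unfold posMins
  refine and_congr_right fun _ => ⟨?_, ?_⟩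
  · intro h y hy
    obtain ⟨i, -, rfl⟩ := hy.exists_pow_eq'
    exact h i
  · intro h l
    exact h _ ⟨l, by simp⟩

lemma mem_allMins {n : ℕ} (σ : Perm (Fin (n+1))) (j : Fin (n+1)) :
    j ∈ allMins σ ↔ ∀ y, σ.SameCycle j y → j ≤ y := by
  unfold allMins
  refine ⟨?_, ?_⟩
  · intro h y hy
    obtain ⟨i, -, rfl⟩ := hy.exists_pow_eq'
    exact h i
  · intro h l
    exact h _ ⟨l, by simp⟩

lemma posMins_fix {n : ℕ} (σ : Perm (Fin (n+1))) :
    posMins (insE (n+1) (Fin.last _, σ)) = insert (Fin.last _) (Fin.castSucc '' posMins σ) := by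
  ext j
  induction j using Fin.lastCases with
  | last =>
    simp [posMins, insE_last_pow_last]
  | cast j =>
    simp [posMins, insE_last_pow, Fin.castSucc_ne_last]

lemma posMins_ins {n : ℕ} (σ : Perm (Fin (n+1))) (a : Fin (n+1)) (ha : ∃ y, y ≠ 0 ∧ σ.SameCycle a y) :
    posMins (insE (n+1) (a.castSucc, σ)) = Fin.castSucc '' posMins σ := by
  ext j
  rw [mem_posMins]
  induction j using Fin.lastCases with
  | last =>
    obtain ⟨y, hy0, hy⟩ := ha
    simp only [Set.mem_image, Fin.castSucc_ne_last, and_false, exists_false, iff_false]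
    rintro ⟨-, h⟩
    have := h y.castSucc (by rw [sc_ins]; simpa using hy) (by simpa using hy0)
    exact absurd this (by simp [Fin.castSucc_lt_last])
  | cast j =>
    simp only [Set.mem_image, Fin.castSucc_inj, exists_eq_right, mem_posMins]
    refine and_congr (by simp) ⟨?_, ?_⟩
    · intro h y hy hy0
      have := h y.castSucc (by rw [sc_ins]; simpa using hy) (by simpa using hy0)
      simpa using this
    · intro h y hy hy0
      induction y using Fin.lastCases with
      | last => exact Fin.le_last _
      | cast y =>
        rw [sc_ins] at hy
        simpa using h y (by simpa using hy) (by simpa using hy0)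

def RecP {n : ℕ} (σ : Perm (Fin (n+1))) (j : Fin (n+1)) : Prop :=
  j ≠ 0 ∧ Relation.ReflTransGen (fun x y => j < x ∧ y = σ x) (σ 0) j

noncomputable def rc {n : ℕ} (σ : Perm (Fin (n+1))) : ℕ := Set.ncard {j | RecP σ j}

lemma path_last {m : ℕ} (f : Fin (m+1) → Fin (m+1)) (u : Fin (m+1)) :
    Relation.ReflTransGen (fun x y => Fin.last m < x ∧ y = f x) u (Fin.last m) ↔ u = Fin.last m := by
  constructor
  · intro h
    rcases h.cases_head with h | ⟨c, ⟨h, _⟩, _⟩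
    · exact h
    · exact absurd h (Fin.le_last _).not_gt
  · rintro rfl; exact .refl

lemma recP_fix {n : ℕ} (σ : Perm (Fin (n+1))) :
    {j | RecP (insE (n+1) (Fin.last _, σ)) j} = Fin.castSucc '' {j | RecP σ j} := by
  have h0 : insE (n+1) (Fin.last _, σ) 0 = (σ 0).castSucc := insE_last_cast σ 0
  ext j
  induction j using Fin.lastCases with
  | last =>
    simp [RecP, path_last, h0, Fin.castSucc_ne_last]
  | cast j =>
    simp only [Set.mem_image, Fin.castSucc_inj, exists_eq_right, Set.mem_ofPred_eq, RecP, h0]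
    refine and_congr (by simp) ⟨?_, ?_⟩
    · suffices ∀ u, Relation.ReflTransGen (fun x y => j.castSucc < x ∧ y = insE (n+1) (Fin.last _, σ) x) u j.castSucc →
          ∀ x, u = x.castSucc → Relation.ReflTransGen (fun x y => j < x ∧ y = σ x) x j from
        fun h => this _ h _ rfl
      intro u h
      induction h using Relation.ReflTransGen.head_induction_on with
      | refl => intro x hx; simp at hx; subst hx; exact .refl
      | head h _ ih =>
        rintro x rfl
        obtain ⟨h1, rfl⟩ := h
        exact .head ⟨by simpa using h1, rfl⟩ (ih _ (insE_last_cast _ _))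
    · intro h
      refine Relation.ReflTransGen.lift Fin.castSucc ?_ _ _ h
      rintro x y ⟨h1, rfl⟩
      exact ⟨by simpa using h1, (insE_last_cast _ _).symm⟩

lemma recP_ins {n : ℕ} (σ : Perm (Fin (n+1))) (a : Fin (n+1)) (j : Fin (n+1)) :
    RecP (insE (n+1) (a.castSucc, σ)) j.castSucc ↔ RecP σ j := by
  have hl : insE (n+1) (a.castSucc, σ) (Fin.last _) = (σ a).castSucc := insE_cast_last a σ
  have h0 : ∀ x, insE (n+1) (a.castSucc, σ) (Fin.castSucc x) = if x = a then Fin.last _ else (σ x).castSucc :=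
    insE_cast_cast a σ
  generalize insE (n+1) (a.castSucc, σ) = σ' at *
  have hlt : j.castSucc < Fin.last _ := Fin.castSucc_lt_last j
  have step : ∀ x, Relation.ReflTransGen (fun x y => j.castSucc < x ∧ y = σ' x) (σ' x.castSucc) (σ x).castSucc := by
    intro x
    rw [h0]
    split_ifs with h
    · subst h
      exact .single ⟨hlt, hl.symm⟩
    · exact .refl
  have h00 := h0 0
  rw [Fin.castSucc_zero] at h00
  refine and_congr (by simp) ⟨?_, ?_⟩
  · suffices ∀ u, Relation.ReflTransGen (fun x y => j.castSucc < x ∧ y = σ' x) u j.castSucc →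
          (∀ x, u = x.castSucc → Relation.ReflTransGen (fun x y => j < x ∧ y = σ x) x j) ∧
          (u = Fin.last _ → Relation.ReflTransGen (fun x y => j < x ∧ y = σ x) (σ a) j) by
      intro h
      have := this _ h
      rw [h00] at this
      split_ifs at this with h
      · rw [h]; exact this.2 rfl
      · exact this.1 _ rfl
    intro u h
    induction h using Relation.ReflTransGen.head_induction_on with
    | refl =>
      refine ⟨fun x hx => ?_, fun h => absurd h (Fin.castSucc_ne_last _)⟩
      simp at hx; subst hx; exact .refl
    | head h _ ih =>
      obtain ⟨h1, rfl⟩ := h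
      refine ⟨?_, ?_⟩
      · rintro x rfl
        refine .head ⟨by simpa using h1, rfl⟩ ?_
        rw [h0] at ih
        split_ifs at ih with h
        · rw [h]; exact ih.2 rfl
        · exact ih.1 _ rfl
      · rintro rfl
        exact ih.1 _ hl
  · intro h
    refine Relation.ReflTransGen.trans (by simpa using step 0) (?_ : Relation.ReflTransGen _ (σ 0).castSucc _)
    refine Relation.ReflTransGen.lift' Fin.castSucc ?_ _ _ h
    rintro x y ⟨h1, rfl⟩
    exact .head ⟨by simpa using h1, rfl⟩ (step x)

lemma rc_fix {n : ℕ} (σ : Perm (Fin (n+1))) : rc (insE (n+1) (Fin.last _, σ)) = rc σ := by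
  rw [rc, recP_fix, Set.ncard_image_of_injective _ (Fin.castSucc_injective _), rc]

lemma recP_ins_last {n : ℕ} (σ : Perm (Fin (n+1))) (a : Fin (n+1)) :
    RecP (insE (n+1) (a.castSucc, σ)) (Fin.last _) ↔ a = 0 := by
  have h0 := insE_cast_cast a σ 0
  rw [Fin.castSucc_zero] at h0
  rw [RecP, path_last, h0]
  by_cases h : 0 = a <;> simp [h, Fin.castSucc_ne_last]
  exact fun h' => h h'.symm

lemma rc_ins {n : ℕ} (σ : Perm (Fin (n+1))) (a : Fin (n+1)) (ha : a ≠ 0) :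
    rc (insE (n+1) (a.castSucc, σ)) = rc σ := by
  have : {j | RecP (insE (n+1) (a.castSucc, σ)) j} = Fin.castSucc '' {j | RecP σ j} := by
    ext j
    induction j using Fin.lastCases with
    | last => simp [recP_ins_last, ha, Fin.castSucc_ne_last]
    | cast j => simp [recP_ins]
  rw [rc, this, Set.ncard_image_of_injective _ (Fin.castSucc_injective _), rc]

lemma rc_ins0 {n : ℕ} (σ : Perm (Fin (n+1))) :
    rc (insE (n+1) (Fin.castSucc 0, σ)) = rc σ + 1 := by
  have : {j | RecP (insE (n+1) (Fin.castSucc 0, σ)) j} = insert (Fin.last _) (Fin.castSucc '' {j | RecP σ j}) := by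
    ext j
    induction j using Fin.lastCases with
    | last => simp only [Set.mem_ofPred_eq, recP_ins_last]; simp
    | cast j => simp only [Set.mem_ofPred_eq, recP_ins]; simp [Fin.castSucc_ne_last]
  rw [rc, this, Set.ncard_insert_of_notMem (by simp [Fin.castSucc_ne_last]),
    Set.ncard_image_of_injective _ (Fin.castSucc_injective _), rc]

lemma path_iff {m : ℕ} (σ : Perm (Fin m)) (u j : Fin m) :
    Relation.ReflTransGen (fun x y => j < x ∧ y = σ x) u j ↔
      ∃ l, (σ ^ l) u = j ∧ ∀ i < l, j < (σ ^ i) u := by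
  constructor
  · intro h
    induction h using Relation.ReflTransGen.head_induction_on with
    | refl => exact ⟨0, by simp, by simp⟩
    | head h _ ih =>
      obtain ⟨h1, rfl⟩ := h
      obtain ⟨l, hl, hl2⟩ := ih
      refine ⟨l+1, by rw [pow_succ, Perm.mul_apply, hl], ?_⟩
      rintro (_ | i) hi
      · simpa using h1
      · rw [pow_succ, Perm.mul_apply]; exact hl2 i (by omega)
  · rintro ⟨l, hl, hl2⟩
    induction l generalizing u with
    | zero => simp at hl; subst hl; exact .refl
    | succ l ih =>
      refine .head ⟨by simpa using hl2 0 (by omega), rfl⟩ (ih (σ u) ?_ ?_)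
      · rw [pow_succ, Perm.mul_apply] at hl; exact hl
      · intro i hi
        have := hl2 (i+1) (by omega)
        rwa [pow_succ, Perm.mul_apply] at this

lemma recP_iff {n : ℕ} (σ : Perm (Fin (n+1))) (j : Fin (n+1)) :
    RecP σ j ↔ j ≠ 0 ∧ ∃ l, (σ ^ (l+1)) 0 = j ∧ ∀ i < l, j < (σ ^ (i+1)) 0 := by
  simp only [RecP, path_iff, pow_succ, Perm.mul_apply]

lemma recCount_eq {n : ℕ} (σ : Perm (Fin (n+1))) :
    recCount ((List.range (Function.minimalPeriod (⇑σ) 0 - 1)).map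
          fun m => ((σ ^ (m + 1)) (0 : Fin (n + 1))).val) = rc σ := by
  set p := Function.minimalPeriod (⇑σ) 0 with hp
  have hpos : 0 < p := by
    apply Function.minimalPeriod_pos_of_mem_periodicPts
    exact σ.injective.mem_periodicPts 0
  have hper : (σ ^ p) 0 = 0 := by
    have := Function.iterate_minimalPeriod (f := ⇑σ) (x := (0 : Fin (n+1)))
    rwa [Perm.iterate_eq_pow] at this
  have hne : ∀ m < p - 1, (σ ^ (m+1)) 0 ≠ 0 := by
    intro m hm h
    refine Function.not_isPeriodicPt_of_pos_of_lt_minimalPeriod (f := ⇑σ) (x := (0 : Fin (n+1))) (n := m+1)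
      (by omega) (by omega) ?_
    rw [Function.IsPeriodicPt, Function.IsFixedPt, Perm.iterate_eq_pow, h]
  have hinj : Set.InjOn (fun m => (σ ^ (m+1)) 0) (Set.Iio (p-1)) := by
    intro x hx y hy h
    have := Function.iterate_injOn_Iio_minimalPeriod (f := ⇑σ) (x := (0 : Fin (n+1)))
      (x₁ := x+1) (x₂ := y+1) (by simp at hx ⊢; omega) (by simp at hy ⊢; omega)
      (by simpa only [Perm.iterate_eq_pow] using h)
    omega
  have hset : {j | RecP σ j} = (((Finset.range (p-1)).filter
      fun j => ∀ i < j, (σ ^ (j+1)) 0 < (σ ^ (i+1)) 0).image (fun m => (σ ^ (m+1)) 0) : Finset _) := by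
    ext j
    simp only [Set.mem_ofPred_eq, recP_iff, Finset.coe_image, Finset.coe_filter, Finset.mem_range, Set.mem_image]
    constructor
    · rintro ⟨h0, l, rfl, hl⟩
      refine ⟨l, ⟨?_, hl⟩, rfl⟩
      by_contra hc
      rcases Nat.lt_or_ge (p-1) l with h | h
      · have := hl _ h
        rw [Nat.sub_add_cancel hpos, hper] at this
        exact absurd this (by simp)
      · have : l + 1 = p := by omega
        rw [this] at h0
        exact h0 hper
    · rintro ⟨l, ⟨h1, h2⟩, rfl⟩
      exact ⟨hne l h1, l, rfl, h2⟩
  rw [rc, hset, Set.ncard_coe_finset, Finset.card_image_of_injOn, recCount]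
  · congr 1
    rw [List.length_map, List.length_range]
    refine Finset.filter_congr fun m hm => ?_
    rw [Finset.mem_range] at hm
    refine forall₂_congr fun i hi => ?_
    rw [List.getD_eq_getElem _ _ (by simpa using hm), List.getD_eq_getElem _ _ (by simp; omega)]
    simp
  · intro x hx y hy h
    simp at hx hy
    exact hinj hx.1 hy.1 h

def Good {n : ℕ} (k : ℕ) (σ τ : Perm (Fin (n+1))) : Prop :=
  τ 0 = 0 ∧ (posMins τ).ncard = k ∧ σ.SameCycle 0 1 ∧ posMins σ = posMins τ

open Classical in
noncomputable def wt {n : ℕ} (k : ℕ) (σ τ : Perm (Fin (n+1))) : ℤ[X] :=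
  if Good k σ τ then X ^ rc σ else 0

noncomputable def PP (n k : ℕ) : ℤ[X] :=
  ∑ σ : Perm (Fin (n+1)), ∑ τ : Perm (Fin (n+1)), wt k σ τ

lemma exists_sc {n : ℕ} {σ : Perm (Fin (n+2))} (h : σ.SameCycle 0 1) (a : Fin (n+2)) :
    ∃ y, y ≠ 0 ∧ σ.SameCycle a y := by
  by_cases ha : a = 0
  · exact ⟨1, by simp, ha ▸ h⟩
  · exact ⟨a, ha, Perm.SameCycle.refl _ _⟩

lemma sc01_ins {n : ℕ} (σ : Perm (Fin (n+2))) (a : Fin (n+2)) :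
    (insE (n+2) (a.castSucc, σ)).SameCycle 0 1 ↔ σ.SameCycle 0 1 := by
  have := sc_ins a σ (Fin.castSucc 0) (Fin.castSucc 1)
  rw [prj_cast, prj_cast] at this
  exact this

lemma sc01_fix {n : ℕ} (σ : Perm (Fin (n+2))) :
    (insE (n+2) (Fin.last _, σ)).SameCycle 0 1 ↔ σ.SameCycle 0 1 := by
  have := sc_fix σ 0 1
  simpa only [Fin.castSucc_zero, Fin.castSucc_one] using this

lemma ins_zero {n : ℕ} (σ : Perm (Fin (n+2))) (a : Fin (n+2)) :
    insE (n+2) (a.castSucc, σ) 0 = 0 ↔ a ≠ 0 ∧ σ 0 = 0 := by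
  have := insE_cast_cast a σ 0
  rw [Fin.castSucc_zero] at this
  rw [this]
  by_cases h : a = 0
  · simp [h, Fin.last_eq_zero_iff]
  · simp [h, Ne.symm h]

lemma fix_zero {n : ℕ} (σ : Perm (Fin (n+2))) :
    insE (n+2) (Fin.last _, σ) 0 = 0 ↔ σ 0 = 0 := by
  have := insE_last_cast σ 0
  rw [Fin.castSucc_zero] at this
  rw [this]
  simp

lemma last_notMem {m : ℕ} (S : Set (Fin m)) : Fin.last m ∉ Fin.castSucc '' S := by
  simp [Fin.castSucc_ne_last]

lemma posMins_ins' {n : ℕ} (σ : Perm (Fin (n+2))) (a : Fin (n+2)) (ha : a ≠ 0) :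
    posMins (insE (n+2) (a.castSucc, σ)) = Fin.castSucc '' posMins σ :=
  posMins_ins σ a ⟨a, ha, Perm.SameCycle.refl _ _⟩

lemma wt_ll {n : ℕ} (k : ℕ) (σ τ : Perm (Fin (n+2))) :
    wt (k+1) (insE (n+2) (Fin.last _, σ)) (insE (n+2) (Fin.last _, τ)) = wt k σ τ := by
  have : Good (k+1) (insE (n+2) (Fin.last _, σ)) (insE (n+2) (Fin.last _, τ)) ↔ Good k σ τ := by
    unfold Good
    rw [fix_zero, sc01_fix, posMins_fix, posMins_fix, Set.ncard_insert_of_notMem (last_notMem _),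
      Set.ncard_image_of_injective _ (Fin.castSucc_injective _), add_left_inj]
    refine and_congr_right fun _ => and_congr_right fun _ => and_congr_right fun _ => ⟨fun h => ?_, fun h => by rw [h]⟩
    have := congrArg (· \ {Fin.last (n+2)}) h
    simp only [Set.insert_sdiff_self_of_notMem (last_notMem _)] at this
    exact Set.image_injective.2 (Fin.castSucc_injective _) this
  unfold wt
  rw [rc_fix]
  by_cases hg : Good k σ τ
  · rw [if_pos hg, if_pos (this.2 hg)]
  · rw [if_neg hg, if_neg (fun h => hg (this.1 h))]

lemma wt_lc {n : ℕ} (k : ℕ) (σ τ : Perm (Fin (n+2))) (b : Fin (n+2)) :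
    wt k (insE (n+2) (Fin.last _, σ)) (insE (n+2) (b.castSucc, τ)) = 0 := by
  unfold wt
  rw [if_neg]
  rintro ⟨h1, -, -, h2⟩
  rw [ins_zero] at h1
  rw [posMins_fix, posMins_ins' _ _ h1.1] at h2
  exact last_notMem _ (h2 ▸ Set.mem_insert _ _)

lemma wt_cl {n : ℕ} (k : ℕ) (σ τ : Perm (Fin (n+2))) (a : Fin (n+2)) :
    wt k (insE (n+2) (a.castSucc, σ)) (insE (n+2) (Fin.last _, τ)) = 0 := by
  unfold wt
  rw [if_neg]
  rintro ⟨-, -, h1, h2⟩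
  rw [sc01_ins] at h1
  rw [posMins_fix, posMins_ins _ _ (exists_sc h1 a)] at h2
  exact last_notMem _ (h2 ▸ Set.mem_insert _ _)

lemma wt_cc {n : ℕ} (k : ℕ) (σ τ : Perm (Fin (n+2))) (a b : Fin (n+2)) :
    wt k (insE (n+2) (a.castSucc, σ)) (insE (n+2) (b.castSucc, τ)) =
      (if a = 0 then X else 1) * ((if b = 0 then 0 else 1) * wt k σ τ) := by
  have : Good k (insE (n+2) (a.castSucc, σ)) (insE (n+2) (b.castSucc, τ)) ↔ b ≠ 0 ∧ Good k σ τ := by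
    unfold Good
    rw [ins_zero, sc01_ins, and_assoc]
    refine and_congr_right fun hb => and_congr_right fun _ => ?_
    rw [posMins_ins' _ _ hb, Set.ncard_image_of_injective _ (Fin.castSucc_injective _)]
    refine and_congr_right fun _ => and_congr_right fun h => ?_
    rw [posMins_ins _ _ (exists_sc h a)]
    exact (Set.image_injective.2 (Fin.castSucc_injective _)).eq_iff
  unfold wt
  by_cases hb : b = 0
  · rw [if_neg (fun h => (this.1 h).1 hb)]; simp [hb]
  · by_cases hg : Good k σ τ
    · rw [if_pos (this.2 ⟨hb, hg⟩), if_pos hg, if_neg hb]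
      by_cases ha : a = 0
      · subst ha
        rw [rc_ins0]
        simp [pow_succ']
      · rw [rc_ins _ _ ha]
        simp [ha]
    · rw [if_neg (fun h => hg (this.1 h).2), if_neg hg]; simp

lemma PP_ins (n k : ℕ) : PP (n+2) k = ∑ a : Fin (n+3), ∑ σ : Perm (Fin (n+2)),
    ∑ b : Fin (n+3), ∑ τ : Perm (Fin (n+2)), wt k (insE (n+2) (a, σ)) (insE (n+2) (b, τ)) := by
  unfold PP
  rw [← (insE (n+2)).sum_comp, Fintype.sum_prod_type]
  refine Finset.sum_congr rfl fun a _ => Finset.sum_congr rfl fun σ _ => ?_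
  rw [← (insE (n+2)).sum_comp, Fintype.sum_prod_type]

lemma PP_rec (n k : ℕ) : PP (n+2) (k+1) = PP (n+1) k +
    C ((n+1 : ℕ) : ℤ) * (C ((n+1 : ℕ) : ℤ) + X) * PP (n+1) (k+1) := by
  have hc : ∑ a : Fin (n+2), (if a = 0 then X else 1 : ℤ[X]) = C ((n+1 : ℕ) : ℤ) + X := by
    rw [Fin.sum_univ_succ]; simp [Fin.succ_ne_zero, add_comm]
  have hd : ∑ a : Fin (n+2), (if a = 0 then 0 else 1 : ℤ[X]) = C ((n+1 : ℕ) : ℤ) := by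
    rw [Fin.sum_univ_succ]; simp [Fin.succ_ne_zero]
  rw [PP_ins, Fin.sum_univ_castSucc]
  simp only [Fin.sum_univ_castSucc (n := n+2), wt_ll, wt_lc, wt_cl, wt_cc, Finset.sum_const_zero, zero_add, add_zero]
  simp only [← Finset.mul_sum, ← Finset.sum_mul, hc, hd]
  unfold PP
  ring

lemma one_mem {n : ℕ} (σ : Perm (Fin (n+2))) : (1 : Fin (n+2)) ∈ posMins σ := by
  rw [mem_posMins]
  exact ⟨by simp, fun y _ hy => Fin.one_le_of_ne_zero hy⟩

lemma PP_zero (n : ℕ) : PP (n+1) 0 = 0 := by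
  unfold PP
  refine Finset.sum_eq_zero fun σ _ => Finset.sum_eq_zero fun τ _ => ?_
  unfold wt
  rw [if_neg]
  rintro ⟨-, h, -⟩
  rw [Set.ncard_eq_zero] at h
  exact absurd (one_mem τ) (by simp [h])

lemma posMins_two (σ : Perm (Fin 2)) : posMins σ = {1} := by
  ext j
  constructor
  · rintro ⟨h, -⟩
    have : ∀ j : Fin 2, j ≠ 0 → j = 1 := by decide
    exact this j h
  · rintro rfl
    exact one_mem (n := 0) σ

lemma rc_two : rc (n := 1) (swap 0 1) = 1 := by
  have : {j | RecP (n := 1) (swap 0 1) j} = {1} := by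
    ext j
    constructor
    · rintro ⟨h, -⟩
      have : ∀ j : Fin 2, j ≠ 0 → j = 1 := by decide
      exact this j h
    · rintro rfl
      refine ⟨by simp, ?_⟩
      simp only [swap_apply_left]
      exact .refl
  rw [rc, this, Set.ncard_singleton]

lemma PP_one (k : ℕ) : PP 1 k = if k = 1 then X else 0 := by
  have hu : (Finset.univ : Finset (Perm (Fin 2))) = {1, swap 0 1} := by decide
  have hne : (1 : Perm (Fin 2)) ≠ swap 0 1 := by decide
  have h1 : ¬ (1 : Perm (Fin 2)).SameCycle 0 1 := by decide
  have h2 : (swap 0 1 : Perm (Fin 2)).SameCycle 0 1 := by decide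
  unfold PP wt Good
  simp only [posMins_two, hu, Finset.sum_pair hne, h1, h2, rc_two]
  simp [eq_comm]

lemma js_zero (n k : ℕ) (h : n < k) : js n k = 0 := by
  induction n generalizing k with
  | zero => obtain ⟨k, rfl⟩ : ∃ m, k = m + 1 := ⟨k-1, by omega⟩; simp [js]
  | succ n ih =>
    obtain ⟨k, rfl⟩ : ∃ m, k = m + 1 := ⟨k-1, by omega⟩
    simp [js, ih k (by omega), ih (k+1) (by omega)]

lemma PP_js (n k : ℕ) : PP (n+1) k = X * ((-1) ^ (n+1+k) * js (n+1) k) := by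
  induction n generalizing k with
  | zero =>
    rw [PP_one]
    rcases k with _ | _ | k <;> simp [js]
  | succ n ih =>
    rcases k with _ | k
    · rw [PP_zero]; simp [js]
    · rw [PP_rec, ih, ih, show js (n+1+1) (k+1) = _ from js.eq_4 (n+1) k]
      ring

lemma allMins_card {n : ℕ} (σ : Perm (Fin (n+2))) (h : σ.SameCycle 0 1) :
    (allMins σ).ncard = (posMins σ).ncard := by
  have e : posMins σ = insert 1 (allMins σ \ {0}) := by
    ext j
    rw [Set.mem_insert_iff, Set.mem_sdiff, Set.mem_singleton_iff]
    constructor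
    · intro hj
      rw [mem_posMins] at hj
      by_cases h0 : σ.SameCycle j 0
      · left
        exact le_antisymm (hj.2 1 (h0.trans h) (by simp)) (Fin.one_le_of_ne_zero hj.1)
      · right
        refine ⟨?_, hj.1⟩
        rw [mem_allMins]
        exact fun y hy => hj.2 y hy (by rintro rfl; exact h0 hy)
    · rintro (rfl | ⟨hj, h0⟩)
      · exact one_mem σ
      · rw [mem_allMins] at hj
        rw [mem_posMins]
        exact ⟨h0, fun y hy _ => hj y hy⟩
  have h0 : (0 : Fin (n+2)) ∈ allMins σ := fun l => Fin.zero_le _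
  have h1 : (1 : Fin (n+2)) ∉ allMins σ := by
    rw [mem_allMins]
    intro hh
    exact absurd (hh 0 h.symm) (by simp)
  rw [e, Set.ncard_insert_of_notMem (fun hh => h1 hh.1), Set.ncard_sdiff_singleton_add_one h0]

/-- The coefficient of `z^i` in `(-1)^(n-k) * js n k` is the number of ordered pairs
`(σ, τ)` where `σ` is a permutation of `[n]₀ = {0,…,n}` with `k` cycles, `τ` is a
permutation of `[n]` with `k` cycles (modelled as a permutation of `[n]₀` fixing `0`),
`1 ∈ Orb_σ(0)`, `min σ = min τ`, and the word `w = σ(0) σ²(0) ⋯ σ^l(0)` (with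
`σ^{l+1}(0) = 0`) has `rec₀(w) = rec(w) - 1 = i`. -/
theorem stmt15 (n k : ℕ) (hn : 1 ≤ n) (hk : 1 ≤ k) (i : ℕ) (hi : i ≤ n - k) :
    ((-1 : Polynomial ℤ) ^ (n - k) * js n k).coeff i =
      (Nat.card {st : Equiv.Perm (Fin (n + 1)) × Equiv.Perm (Fin (n + 1)) //
        Nat.card (allMins st.1) = k ∧
        st.2 0 = 0 ∧ Nat.card (posMins st.2) = k ∧
        st.1.SameCycle 0 1 ∧
        posMins st.1 = posMins st.2 ∧
        recCount ((List.range (Function.minimalPeriod (⇑st.1) 0 - 1)).map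
          fun m => ((st.1 ^ (m + 1)) (0 : Fin (n + 1))).val) = i + 1} : ℤ) := by
  classical
  obtain ⟨n, rfl⟩ : ∃ m, n = m + 1 := ⟨n - 1, by omega⟩
  have hsign : (-1 : Polynomial ℤ) ^ (n + 1 - k) * js (n+1) k = (-1) ^ (n+1+k) * js (n+1) k := by
    rcases Nat.lt_or_ge (n+1) k with h | h
    · simp [js_zero _ _ h]
    · congr 1
      have : n + 1 + k = (n + 1 - k) + 2 * k := by omega
      rw [this, pow_add, pow_mul]
      simp
  rw [hsign, ← coeff_X_mul, ← PP_js]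
  simp only [recCount_eq]
  have hp : ∀ st : Equiv.Perm (Fin (n + 1 + 1)) × Equiv.Perm (Fin (n + 1 + 1)),
      (Nat.card (allMins st.1) = k ∧ st.2 0 = 0 ∧ Nat.card (posMins st.2) = k ∧
        st.1.SameCycle 0 1 ∧ posMins st.1 = posMins st.2 ∧ rc st.1 = i + 1) ↔
      (Good k st.1 st.2 ∧ rc st.1 = i + 1) := by
    intro st
    simp only [Nat.card_coe_set_eq]
    constructor
    · rintro ⟨_, h2, h3, h4, h5, h6⟩
      exact ⟨⟨h2, h3, h4, h5⟩, h6⟩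
    · rintro ⟨⟨h2, h3, h4, h5⟩, h6⟩
      exact ⟨by rw [allMins_card _ h4, h5, h3], h2, h3, h4, h5, h6⟩
  simp only [hp]
  rw [Nat.card_eq_fintype_card, Fintype.card_subtype, Finset.card_filter]
  unfold PP wt
  rw [← Fintype.sum_prod_type', finsetSum_coeff]
  push_cast
  refine Finset.sum_congr rfl fun st _ => ?_
  by_cases hg : Good k st.1 st.2
  · simp [hg, coeff_X_pow, eq_comm]
  · simp [hg]
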